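/- Suppose $u \in C^2(\mathbb{S}^2)$ solves $\alpha \Delta u + \frac{1 - \sum_i a_i x_i}{1 - |a|^2} e^{2u} - 1 = 0$ on $\mathbb{S}^2$ with $\int_{\mathbb{S}^2} e^{2u}\,d\omega = 1$ and $\int_{\mathbb{S}^2} e^{2u} x_i\,d\omega = a_i$ for $i=1,2,3$, where $a = (a_1,a_2,a_3)$, $|a| < 1$, $a \ne 0$, and $\alpha \in (0,1)$, $\alpha \ne 2/3$. Then the Kazdan–Warner identities force $(3 - \frac{2}{\alpha})\int_{\mathbb{S}^2}\big(|a|^2 - (a\cdot x)^2\big)e^{2u}\,d\omega = 0$, hence a contradiction; i.e., any such solution must have $a = 0$. -/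

import Mathlib

open MeasureTheory

/-- The uniform probability measure on the unit sphere `S² ⊂ ℝ³`. -/
noncomputable def sphereMeasure : Measure (EuclideanSpace ℝ (Fin 3)) :=
  ((μH[2] : Measure (EuclideanSpace ℝ (Fin 3))) (Metric.sphere 0 1))⁻¹ •
    (μH[2] : Measure (EuclideanSpace ℝ (Fin 3))).restrict (Metric.sphere 0 1)

/-- Degree-zero homogeneous extension of a function on `S²`. -/
noncomputable def sphExt (u : EuclideanSpace ℝ (Fin 3) → ℝ) :
    EuclideanSpace ℝ (Fin 3) → ℝ :=
  fun y => u (‖y‖⁻¹ • y)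

/-- Laplace–Beltrami operator on `S²`, via the Euclidean Laplacian of the
degree-zero homogeneous extension. -/
noncomputable def sphLap (u : EuclideanSpace ℝ (Fin 3) → ℝ) (x : EuclideanSpace ℝ (Fin 3)) : ℝ :=
  ∑ i : Fin 3, fderiv ℝ (fun z => fderiv ℝ (sphExt u) z (EuclideanSpace.single i 1)) x
    (EuclideanSpace.single i 1)


noncomputable def pd (k : Fin 3) (f : (EuclideanSpace ℝ (Fin 3)) → ℝ) (x : (EuclideanSpace ℝ (Fin 3))) : ℝ :=
  fderiv ℝ f x (EuclideanSpace.single k 1)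

theorem sm_ae : ∀ᵐ x ∂sphereMeasure, ‖x‖ = 1 := by
  unfold sphereMeasure
  refine Measure.ae_smul_measure ?_ _
  filter_upwards [ae_restrict_mem (Metric.isClosed_sphere.measurableSet)] with x hx
  simpa using hx

theorem sm_finite : IsFiniteMeasure sphereMeasure := by
  unfold sphereMeasure
  constructor
  simp only [Measure.smul_apply, Measure.restrict_apply MeasurableSet.univ, Set.univ_inter, smul_eq_mul]
  exact lt_of_le_of_lt (ENNReal.inv_mul_le_one _) ENNReal.one_lt_top

theorem sm_pres (g : (EuclideanSpace ℝ (Fin 3)) ≃ₗᵢ[ℝ] (EuclideanSpace ℝ (Fin 3))) : MeasurePreserving g sphereMeasure sphereMeasure := by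
  unfold sphereMeasure
  refine MeasurePreserving.smul_measure ?_ _
  have h := (IsometryEquiv.measurePreserving_hausdorffMeasure g.toIsometryEquiv 2).restrict_preimage
    (s := Metric.sphere (0 : (EuclideanSpace ℝ (Fin 3))) 1) Metric.isClosed_sphere.measurableSet
  have e : g.toIsometryEquiv ⁻¹' (Metric.sphere (0 : (EuclideanSpace ℝ (Fin 3))) 1) = Metric.sphere (0 : (EuclideanSpace ℝ (Fin 3))) 1 := by
    ext x; simp
  rw [e] at h
  exact h

theorem sm_aesm {f : (EuclideanSpace ℝ (Fin 3)) → ℝ} (hf : ContinuousOn f {0}ᶜ) :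
    AEStronglyMeasurable f sphereMeasure := by
  unfold sphereMeasure
  refine AEStronglyMeasurable.smul_measure ?_ _
  refine ContinuousOn.aestronglyMeasurable (hf.mono ?_) Metric.isClosed_sphere.measurableSet
  intro x hx h
  simp at hx h
  simp [h] at hx

theorem sm_bdd {f : (EuclideanSpace ℝ (Fin 3)) → ℝ} (hf : ContinuousOn f {0}ᶜ) :
    ∃ C, ∀ x : (EuclideanSpace ℝ (Fin 3)), ‖x‖ = 1 → ‖f x‖ ≤ C := by
  obtain ⟨C, hC⟩ := (isCompact_sphere (0 : (EuclideanSpace ℝ (Fin 3))) 1).exists_bound_of_continuousOn (f := f) (hf.mono (by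
    intro x hx h
    simp at hx h
    simp [h] at hx))
  exact ⟨C, fun x hx => hC x (by simpa using hx)⟩

theorem sm_int {f : (EuclideanSpace ℝ (Fin 3)) → ℝ} (hf : ContinuousOn f {0}ᶜ) : Integrable f sphereMeasure := by
  have := sm_finite
  obtain ⟨C, hC⟩ := sm_bdd hf
  refine Integrable.of_bound (sm_aesm hf) C ?_
  filter_upwards [sm_ae] with x hx using hC x hx

theorem ne_of_norm {x : (EuclideanSpace ℝ (Fin 3))} (hx : ‖x‖ = 1) : x ∈ ({0}ᶜ : Set (EuclideanSpace ℝ (Fin 3))) := by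
  intro h
  simp at h
  simp [h] at hx

theorem open_c : IsOpen ({0}ᶜ : Set (EuclideanSpace ℝ (Fin 3))) := isClosed_singleton.isOpen_compl

/-- Invariance under one-parameter groups of rotations. -/
theorem killing {f : (EuclideanSpace ℝ (Fin 3)) → ℝ} (hf : ContDiffOn ℝ 1 f {0}ᶜ) (A : (EuclideanSpace ℝ (Fin 3)) →L[ℝ] (EuclideanSpace ℝ (Fin 3)))
    (hA : A ∈ skewAdjoint ((EuclideanSpace ℝ (Fin 3)) →L[ℝ] (EuclideanSpace ℝ (Fin 3)))) :
    ∫ x, fderiv ℝ f x (A x) ∂sphereMeasure = 0 := by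
  have := sm_finite
  have hU : ∀ s : ℝ, NormedSpace.exp (s • A) ∈ unitary ((EuclideanSpace ℝ (Fin 3)) →L[ℝ] (EuclideanSpace ℝ (Fin 3))) := by
    intro s
    let _ : NormedAlgebra ℚ ((EuclideanSpace ℝ (Fin 3)) →L[ℝ] (EuclideanSpace ℝ (Fin 3))) := NormedAlgebra.restrictScalars ℚ ℝ _
    have := NormedSpace.exp_mem_unitary_of_mem_skewAdjoint (skewAdjoint.smul_mem s hA)
    exact this
  let g : ℝ → ((EuclideanSpace ℝ (Fin 3)) ≃ₗᵢ[ℝ] (EuclideanSpace ℝ (Fin 3))) := fun s => Unitary.linearIsometryEquiv ⟨_, hU s⟩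
  have hg : ∀ s x, g s x = NormedSpace.exp (s • A) x := fun s x => rfl
  have hgc : ∀ s, ContinuousOn (fun x => g s x) ({0}ᶜ : Set (EuclideanSpace ℝ (Fin 3))) := fun s => (g s).continuous.continuousOn
  have hm : ∀ s, Set.MapsTo (fun x => g s x) ({0}ᶜ : Set (EuclideanSpace ℝ (Fin 3))) {0}ᶜ := by
    intro s x hx; simpa using hx
  have hder : ContinuousOn (fun x => fderiv ℝ f x (A x)) {0}ᶜ := 
    (hf.continuousOn_fderiv_of_isOpen open_c le_rfl).clm_apply A.continuous.continuousOn
  obtain ⟨C, hC⟩ := sm_bdd hder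
  have key := hasDerivAt_integral_of_dominated_loc_of_deriv_le (μ := sphereMeasure) (𝕜 := ℝ)
    (F := fun s x => f (g s x)) (F' := fun s x => fderiv ℝ f (g s x) (A (g s x))) (x₀ := 0)
    (s := Set.univ) (bound := fun _ => C) Filter.univ_mem
    (Filter.Eventually.of_forall fun s => sm_aesm (hf.continuousOn.comp (hgc s) (hm s)))
    (sm_int (hf.continuousOn.comp (hgc 0) (hm 0)))
    (sm_aesm (hder.comp (hgc 0) (hm 0)))
    (by
      filter_upwards [sm_ae] with x hx s _
      exact hC _ (by simpa using hx))
    (integrable_const C)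
    (by
      filter_upwards [sm_ae] with x hx s _
      have h0 : g s x ∈ ({0}ᶜ : Set (EuclideanSpace ℝ (Fin 3))) := hm s (ne_of_norm hx)
      have h1 : HasFDerivAt f (fderiv ℝ f (g s x)) (g s x) :=
        ((hf.differentiableOn one_ne_zero).differentiableAt (open_c.mem_nhds h0)).hasFDerivAt
      have h2 : HasDerivAt (fun s => g s x) (A (g s x)) s := by
        have := (hasDerivAt_exp_smul_const' (𝕂 := ℝ) A s).clm_apply (hasDerivAt_const s x)
        simp only [mul_apply_eq_comp, map_zero, add_zero] at this
        exact this
      exact h1.comp_hasDerivAt s h2)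
  have hconst : ∀ s, ∫ x, f (g s x) ∂sphereMeasure = ∫ x, f x ∂sphereMeasure := fun s =>
    (sm_pres (g s)).integral_comp (g s).toHomeomorph.measurableEmbedding f
  have h3 := key.2
  simp only [hconst] at h3
  have h4 := h3.unique (hasDerivAt_const _ _)
  rw [← h4]
  have hz : ∀ x, g 0 x = x := by
    intro x
    have h5 : NormedSpace.exp ((0 : ℝ) • A) = 1 := by
      have h6 : (0 : ℝ) • A = 0 := by ext; simp
      rw [h6]; exact NormedSpace.exp_zero
    rw [hg, h5]; rfl
  refine integral_congr_ae (Filter.Eventually.of_forall fun x => ?_)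
  simp only [hz]

theorem killing_ij {f : (EuclideanSpace ℝ (Fin 3)) → ℝ} (hf : ContDiffOn ℝ 1 f {0}ᶜ) (i j : Fin 3) :
    ∫ x, (x i * pd j f x - x j * pd i f x) ∂sphereMeasure = 0 := by
  let A : (EuclideanSpace ℝ (Fin 3)) →L[ℝ] (EuclideanSpace ℝ (Fin 3)) :=
    (EuclideanSpace.proj i : (EuclideanSpace ℝ (Fin 3)) →L[ℝ] ℝ).smulRight (EuclideanSpace.single j (1:ℝ)) -
    (EuclideanSpace.proj j : (EuclideanSpace ℝ (Fin 3)) →L[ℝ] ℝ).smulRight (EuclideanSpace.single i (1:ℝ))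
  have hA : A ∈ skewAdjoint ((EuclideanSpace ℝ (Fin 3)) →L[ℝ] (EuclideanSpace ℝ (Fin 3))) := by
    rw [skewAdjoint.mem_iff, ContinuousLinearMap.star_eq_adjoint]
    symm
    rw [ContinuousLinearMap.eq_adjoint_iff]
    intro x y
    simp [A, inner_sub_left, inner_sub_right, inner_smul_left, inner_smul_right,
      EuclideanSpace.inner_single_left, EuclideanSpace.inner_single_right]
    ring
  have := killing hf A hA
  rw [← this]
  refine integral_congr_ae (Filter.Eventually.of_forall fun x => ?_)
  simp [A, pd]

theorem cd_diff {f : (EuclideanSpace ℝ (Fin 3)) → ℝ} (hf : ContDiffOn ℝ 1 f {0}ᶜ) {x : (EuclideanSpace ℝ (Fin 3))} (hx : x ∈ ({0}ᶜ : Set (EuclideanSpace ℝ (Fin 3)))) :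
    DifferentiableAt ℝ f x :=
  (hf.differentiableOn one_ne_zero).differentiableAt (open_c.mem_nhds hx)

theorem pd_cont {f : (EuclideanSpace ℝ (Fin 3)) → ℝ} (hf : ContDiffOn ℝ 1 f {0}ᶜ) (k : Fin 3) :
    ContinuousOn (pd k f) {0}ᶜ :=
  (hf.continuousOn_fderiv_of_isOpen open_c le_rfl).clm_apply continuousOn_const

theorem pd_cd {f : (EuclideanSpace ℝ (Fin 3)) → ℝ} (hf : ContDiffOn ℝ 2 f {0}ᶜ) (k : Fin 3) :
    ContDiffOn ℝ 1 (pd k f) {0}ᶜ :=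
  (hf.fderiv_of_isOpen open_c (by norm_num)).clm_apply contDiffOn_const

theorem pd_mul {f g : (EuclideanSpace ℝ (Fin 3)) → ℝ} {x : (EuclideanSpace ℝ (Fin 3))} (hf : DifferentiableAt ℝ f x) (hg : DifferentiableAt ℝ g x)
    (k : Fin 3) : pd k (fun y => f y * g y) x = pd k f x * g x + f x * pd k g x := by
  unfold pd
  rw [fderiv_fun_mul hf hg]
  simp
  ring

theorem pd_add {f g : (EuclideanSpace ℝ (Fin 3)) → ℝ} {x : (EuclideanSpace ℝ (Fin 3))} (hf : DifferentiableAt ℝ f x) (hg : DifferentiableAt ℝ g x)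
    (k : Fin 3) : pd k (fun y => f y + g y) x = pd k f x + pd k g x := by
  unfold pd
  rw [fderiv_fun_add hf hg]
  simp

theorem pd_const (c : ℝ) (x : (EuclideanSpace ℝ (Fin 3))) (k : Fin 3) : pd k (fun _ => c) x = 0 := by
  simp [pd]

theorem pd_coord (i k : Fin 3) (x : (EuclideanSpace ℝ (Fin 3))) : pd k (fun y : (EuclideanSpace ℝ (Fin 3)) => y i) x = if i = k then 1 else 0 := by
  unfold pd
  have : HasFDerivAt (fun y : (EuclideanSpace ℝ (Fin 3)) => y i) (EuclideanSpace.proj i : (EuclideanSpace ℝ (Fin 3)) →L[ℝ] ℝ) x :=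
    (EuclideanSpace.proj i : (EuclideanSpace ℝ (Fin 3)) →L[ℝ] ℝ).hasFDerivAt
  rw [this.fderiv]
  simp

theorem cd_coord (i : Fin 3) : ContDiffOn ℝ 1 (fun y : (EuclideanSpace ℝ (Fin 3)) => y i) {0}ᶜ :=
  (EuclideanSpace.proj i : (EuclideanSpace ℝ (Fin 3)) →L[ℝ] ℝ).contDiff.contDiffOn

noncomputable def divS (V : Fin 3 → (EuclideanSpace ℝ (Fin 3)) → ℝ) (x : (EuclideanSpace ℝ (Fin 3))) : ℝ :=
  (∑ j, pd j (V j) x) - 2 * (∑ j, x j * V j x) - ∑ i, ∑ j, x i * x j * pd i (V j) x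

theorem nsq {x : (EuclideanSpace ℝ (Fin 3))} (hx : ‖x‖ = 1) : x 0 ^ 2 + x 1 ^ 2 + x 2 ^ 2 = 1 := by
  have := EuclideanSpace.real_norm_sq_eq x
  rw [hx, Fin.sum_univ_three] at this
  linarith

theorem div_thm (V : Fin 3 → (EuclideanSpace ℝ (Fin 3)) → ℝ) (hV : ∀ j, ContDiffOn ℝ 1 (V j) {0}ᶜ)
    {D : (EuclideanSpace ℝ (Fin 3)) → ℝ} (hD : ∀ x, ‖x‖ = 1 → divS V x = D x) :
    ∫ x, D x ∂sphereMeasure = 0 := by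
  have hf : ∀ i j, ContDiffOn ℝ 1 (fun x => x i * V j x) {0}ᶜ := fun i j =>
    (cd_coord i).mul (hV j)
  have h1 : ∫ x, ∑ i, ∑ j, (x i * pd j (fun x => x i * V j x) x - x j * pd i (fun x => x i * V j x) x)
      ∂sphereMeasure = 0 := by
    have hi : ∀ i j, Integrable (fun x : (EuclideanSpace ℝ (Fin 3)) => x i * pd j (fun x => x i * V j x) x - x j * pd i (fun x => x i * V j x) x) sphereMeasure := by
      intro i j
      apply sm_int
      exact ((cd_coord i).continuousOn.mul (pd_cont (hf i j) j)).sub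
        ((cd_coord j).continuousOn.mul (pd_cont (hf i j) i))
    rw [integral_finsetSum _ (fun i _ => integrable_finsetSum _ (fun j _ => hi i j))]
    refine Finset.sum_eq_zero fun i _ => ?_
    rw [integral_finsetSum _ (fun j _ => hi i j)]
    exact Finset.sum_eq_zero fun j _ => killing_ij (hf i j) i j
  rw [← h1]
  refine integral_congr_ae ?_
  filter_upwards [sm_ae] with x hx
  rw [← hD x hx]
  have hx0 := ne_of_norm hx
  simp only [pd_mul (cd_diff (cd_coord _) hx0) (cd_diff (hV _) hx0), pd_coord, divS,
    Fin.sum_univ_three]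
  simp
  have := nsq hx
  linear_combination (- pd 0 (V 0) x - pd 1 (V 1) x - pd 2 (V 2) x) * this

theorem pd_exp {f : (EuclideanSpace ℝ (Fin 3)) → ℝ} {x : (EuclideanSpace ℝ (Fin 3))} (hf : DifferentiableAt ℝ f x) (k : Fin 3) :
    pd k (fun y => Real.exp (2 * f y)) x = 2 * Real.exp (2 * f x) * pd k f x := by
  unfold pd
  rw [fderiv_exp (hf.const_mul 2), fderiv_const_mul hf]
  simp
  ring

theorem euler (u : (EuclideanSpace ℝ (Fin 3)) → ℝ) (hu : ContDiffOn ℝ 2 (sphExt u) {0}ᶜ) {x : (EuclideanSpace ℝ (Fin 3))}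
    (hx : x ∈ ({0}ᶜ : Set (EuclideanSpace ℝ (Fin 3)))) :
    x 0 * pd 0 (sphExt u) x + x 1 * pd 1 (sphExt u) x + x 2 * pd 2 (sphExt u) x = 0 := by
  have hd := (cd_diff (hu.of_le (by norm_num)) hx).hasFDerivAt
  have h1 : HasDerivAt (fun s : ℝ => s • x) x 1 := by
    simpa using (hasDerivAt_id (1 : ℝ)).smul_const x
  have h2 : HasDerivAt (fun s : ℝ => sphExt u (s • x)) (fderiv ℝ (sphExt u) x x) 1 := by
    have hd' : HasFDerivAt (sphExt u) (fderiv ℝ (sphExt u) x) ((1 : ℝ) • x) := by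
      rw [one_smul]; exact hd
    have h := HasFDerivAt.comp_hasDerivAt (l := sphExt u) (f := fun s : ℝ => s • x) (1 : ℝ) hd' h1
    exact h
  have h3 : (fun s : ℝ => sphExt u (s • x)) =ᶠ[nhds 1] fun _ => sphExt u x := by
    filter_upwards [lt_mem_nhds (show (0 : ℝ) < 1 by norm_num)] with s hs
    unfold sphExt
    congr 1
    rw [norm_smul, smul_smul, Real.norm_eq_abs, abs_of_pos hs, mul_inv]
    congr 1
    field_simp
  have h4 := h2.unique ((hasDerivAt_const (1 : ℝ) (sphExt u x)).congr_of_eventuallyEq h3)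
  have h5 : x = x 0 • EuclideanSpace.single 0 (1 : ℝ) + x 1 • EuclideanSpace.single 1 (1 : ℝ)
      + x 2 • EuclideanSpace.single 2 (1 : ℝ) := by
    ext i
    fin_cases i <;> simp
  have h6 : fderiv ℝ (sphExt u) x x = fderiv ℝ (sphExt u) x (x 0 • EuclideanSpace.single 0 (1 : ℝ)
      + x 1 • EuclideanSpace.single 1 (1 : ℝ) + x 2 • EuclideanSpace.single 2 (1 : ℝ)) :=
    congrArg _ h5
  rw [h4] at h6
  simp only [map_add, map_smul, smul_eq_mul] at h6
  exact h6.symm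

theorem euler2 (u : (EuclideanSpace ℝ (Fin 3)) → ℝ) (hu : ContDiffOn ℝ 2 (sphExt u) {0}ᶜ) {x : (EuclideanSpace ℝ (Fin 3))}
    (hx : x ∈ ({0}ᶜ : Set (EuclideanSpace ℝ (Fin 3)))) (k : Fin 3) :
    pd k (sphExt u) x + x 0 * pd k (pd 0 (sphExt u)) x + x 1 * pd k (pd 1 (sphExt u)) x
      + x 2 * pd k (pd 2 (sphExt u)) x = 0 := by
  have h1 : (fun x : (EuclideanSpace ℝ (Fin 3)) => x 0 * pd 0 (sphExt u) x + x 1 * pd 1 (sphExt u) x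
      + x 2 * pd 2 (sphExt u) x) =ᶠ[nhds x] fun _ => 0 := by
    filter_upwards [open_c.mem_nhds hx] with y hy using euler u hu hy
  have h2 : pd k (fun x : (EuclideanSpace ℝ (Fin 3)) => x 0 * pd 0 (sphExt u) x + x 1 * pd 1 (sphExt u) x
      + x 2 * pd 2 (sphExt u) x) x = 0 := by
    unfold pd at h1 ⊢
    rw [h1.fderiv_eq]
    simp
  have c : ∀ i, DifferentiableAt ℝ (fun x : (EuclideanSpace ℝ (Fin 3)) => x i) x := fun i => cd_diff (cd_coord i) hx
  have d : ∀ i, DifferentiableAt ℝ (pd i (sphExt u)) x := fun i => cd_diff (pd_cd hu i) hx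
  rw [pd_add (((c 0).fun_mul (d 0)).fun_add ((c 1).fun_mul (d 1))) ((c 2).fun_mul (d 2)),
    pd_add ((c 0).fun_mul (d 0)) ((c 1).fun_mul (d 1)), pd_mul (c 0) (d 0), pd_mul (c 1) (d 1),
    pd_mul (c 2) (d 2)] at h2
  simp only [pd_coord] at h2
  fin_cases k <;> simp at h2 ⊢ <;> linarith

theorem pd_symm {f : (EuclideanSpace ℝ (Fin 3)) → ℝ} (hf : ContDiffOn ℝ 2 f {0}ᶜ) {x : (EuclideanSpace ℝ (Fin 3))}
    (hx : x ∈ ({0}ᶜ : Set (EuclideanSpace ℝ (Fin 3)))) (i j : Fin 3) : pd i (pd j f) x = pd j (pd i f) x := by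
  have h1 : ContDiffAt ℝ 2 f x := hf.contDiffAt (open_c.mem_nhds hx)
  have h2 := h1.isSymmSndFDerivAt (by simp)
  have hd : DifferentiableAt ℝ (fderiv ℝ f) x :=
    (h1.fderiv_right (m := 1) (by norm_num)).differentiableAt one_ne_zero
  have h3 : ∀ i j, pd i (pd j f) x =
      fderiv ℝ (fderiv ℝ f) x (EuclideanSpace.single i 1) (EuclideanSpace.single j 1) := by
    intro i j
    change fderiv ℝ (fun y => fderiv ℝ f y (EuclideanSpace.single j 1)) x _ = _
    rw [fderiv_clm_apply hd (differentiableAt_const _)]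
    simp
  rw [h3, h3]
  exact h2 _ _

/-- The linear function `a · x`. -/
noncomputable def lin (a x : (EuclideanSpace ℝ (Fin 3))) : ℝ := ∑ i, a i * x i

theorem lin_cd (a : (EuclideanSpace ℝ (Fin 3))) : ContDiffOn ℝ 1 (lin a) {0}ᶜ := by
  unfold lin
  exact ContDiffOn.sum fun i _ => contDiffOn_const.mul (cd_coord i)

theorem pd_lin (a : (EuclideanSpace ℝ (Fin 3))) (x : (EuclideanSpace ℝ (Fin 3))) (k : Fin 3) : pd k (lin a) x = a k := by
  have : HasFDerivAt (lin a) (∑ i, a i • (EuclideanSpace.proj i : (EuclideanSpace ℝ (Fin 3)) →L[ℝ] ℝ)) x := by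
    unfold lin
    exact HasFDerivAt.fun_sum fun i _ =>
      ((EuclideanSpace.proj i : (EuclideanSpace ℝ (Fin 3)) →L[ℝ] ℝ).hasFDerivAt).const_mul (a i)
  unfold pd
  rw [this.fderiv]
  fin_cases k <;> simp [Fin.sum_univ_three]

theorem lin3 (a x : (EuclideanSpace ℝ (Fin 3))) : lin a x = a 0 * x 0 + a 1 * x 1 + a 2 * x 2 := by
  simp [lin, Fin.sum_univ_three]

/-- The function `a · ∇F`. -/
noncomputable def aw (a : (EuclideanSpace ℝ (Fin 3))) (F : (EuclideanSpace ℝ (Fin 3)) → ℝ) (x : (EuclideanSpace ℝ (Fin 3))) : ℝ :=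
  a 0 * pd 0 F x + a 1 * pd 1 F x + a 2 * pd 2 F x

/-- The function `|∇F|²`. -/
noncomputable def gsq (F : (EuclideanSpace ℝ (Fin 3)) → ℝ) (x : (EuclideanSpace ℝ (Fin 3))) : ℝ :=
  pd 0 F x * pd 0 F x + pd 1 F x * pd 1 F x + pd 2 F x * pd 2 F x

noncomputable def lapE (F : (EuclideanSpace ℝ (Fin 3)) → ℝ) (x : (EuclideanSpace ℝ (Fin 3))) : ℝ :=
  pd 0 (pd 0 F) x + pd 1 (pd 1 F) x + pd 2 (pd 2 F) x

theorem aw_cd (a : (EuclideanSpace ℝ (Fin 3))) {F : (EuclideanSpace ℝ (Fin 3)) → ℝ} (hF : ContDiffOn ℝ 2 F {0}ᶜ) :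
    ContDiffOn ℝ 1 (aw a F) {0}ᶜ := by
  unfold aw
  exact ((contDiffOn_const.mul (pd_cd hF 0)).add (contDiffOn_const.mul (pd_cd hF 1))).add
    (contDiffOn_const.mul (pd_cd hF 2))

theorem gsq_cd {F : (EuclideanSpace ℝ (Fin 3)) → ℝ} (hF : ContDiffOn ℝ 2 F {0}ᶜ) :
    ContDiffOn ℝ 1 (gsq F) {0}ᶜ := by
  unfold gsq
  exact (((pd_cd hF 0).mul (pd_cd hF 0)).add ((pd_cd hF 1).mul (pd_cd hF 1))).add
    ((pd_cd hF 2).mul (pd_cd hF 2))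

theorem lapE_cont {F : (EuclideanSpace ℝ (Fin 3)) → ℝ} (hF : ContDiffOn ℝ 2 F {0}ᶜ) :
    ContinuousOn (lapE F) {0}ᶜ := by
  unfold lapE
  exact ((pd_cont (pd_cd hF 0) 0).add (pd_cont (pd_cd hF 1) 1)).add (pd_cont (pd_cd hF 2) 2)

theorem pd_aw (a : (EuclideanSpace ℝ (Fin 3))) {F : (EuclideanSpace ℝ (Fin 3)) → ℝ} (hF : ContDiffOn ℝ 2 F {0}ᶜ) {x : (EuclideanSpace ℝ (Fin 3))}
    (hx : x ∈ ({0}ᶜ : Set (EuclideanSpace ℝ (Fin 3)))) (k : Fin 3) : pd k (aw a F) x =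
    a 0 * pd k (pd 0 F) x + a 1 * pd k (pd 1 F) x + a 2 * pd k (pd 2 F) x := by
  have d : ∀ i, DifferentiableAt ℝ (pd i F) x := fun i => cd_diff (pd_cd hF i) hx
  have c : ∀ i, DifferentiableAt ℝ (fun _ : (EuclideanSpace ℝ (Fin 3)) => a i) x := fun i => differentiableAt_const _
  unfold aw
  rw [pd_add (((c 0).fun_mul (d 0)).fun_add ((c 1).fun_mul (d 1))) ((c 2).fun_mul (d 2)),
    pd_add ((c 0).fun_mul (d 0)) ((c 1).fun_mul (d 1)), pd_mul (c 0) (d 0), pd_mul (c 1) (d 1),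
    pd_mul (c 2) (d 2)]
  simp only [pd_const]
  ring

theorem pd_gsq {F : (EuclideanSpace ℝ (Fin 3)) → ℝ} (hF : ContDiffOn ℝ 2 F {0}ᶜ) {x : (EuclideanSpace ℝ (Fin 3))}
    (hx : x ∈ ({0}ᶜ : Set (EuclideanSpace ℝ (Fin 3)))) (k : Fin 3) : pd k (gsq F) x =
    2 * (pd 0 F x * pd k (pd 0 F) x + pd 1 F x * pd k (pd 1 F) x + pd 2 F x * pd k (pd 2 F) x) := by
  have d : ∀ i, DifferentiableAt ℝ (pd i F) x := fun i => cd_diff (pd_cd hF i) hx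
  unfold gsq
  rw [pd_add (((d 0).fun_mul (d 0)).fun_add ((d 1).fun_mul (d 1))) ((d 2).fun_mul (d 2)),
    pd_add ((d 0).fun_mul (d 0)) ((d 1).fun_mul (d 1)), pd_mul (d 0) (d 0), pd_mul (d 1) (d 1),
    pd_mul (d 2) (d 2)]
  ring

theorem KW1 (a : (EuclideanSpace ℝ (Fin 3))) (u : (EuclideanSpace ℝ (Fin 3)) → ℝ) (hu : ContDiffOn ℝ 2 (sphExt u) {0}ᶜ) :
    ∫ x, (aw a (sphExt u) x * lapE (sphExt u) x) ∂sphereMeasure = 0 := by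
  have key := div_thm (fun j x => 2 * (aw a (sphExt u) x * pd j (sphExt u) x)
      + gsq (sphExt u) x * (- a j))
    (fun j => (contDiffOn_const.mul ((aw_cd a hu).mul (pd_cd hu j))).add
      ((gsq_cd hu).mul contDiffOn_const))
    (D := fun x => 2 * (aw a (sphExt u) x * lapE (sphExt u) x)) (by
      intro x hx
      have hx0 := ne_of_norm hx
      have d : ∀ i, DifferentiableAt ℝ (pd i (sphExt u)) x := fun i => cd_diff (pd_cd hu i) hx0
      have da := cd_diff (aw_cd a hu) hx0
      have dg := cd_diff (gsq_cd hu) hx0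
      have hpd : ∀ k j, pd k (fun x => 2 * (aw a (sphExt u) x * pd j (sphExt u) x)
          + gsq (sphExt u) x * (- a j)) x = 2 * ((a 0 * pd k (pd 0 (sphExt u)) x
            + a 1 * pd k (pd 1 (sphExt u)) x + a 2 * pd k (pd 2 (sphExt u)) x)
            * pd j (sphExt u) x + aw a (sphExt u) x * pd k (pd j (sphExt u)) x)
          - 2 * (pd 0 (sphExt u) x * pd k (pd 0 (sphExt u)) x + pd 1 (sphExt u) x
            * pd k (pd 1 (sphExt u)) x + pd 2 (sphExt u) x * pd k (pd 2 (sphExt u)) x) * a j := by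
        intro k j
        rw [pd_add ((differentiableAt_const _).fun_mul (da.fun_mul (d j))) (dg.fun_mul (differentiableAt_const _)),
          pd_mul (differentiableAt_const _) (da.fun_mul (d j)), pd_mul da (d j),
          pd_mul dg (differentiableAt_const _), pd_const, pd_const, pd_aw a hu hx0,
          pd_gsq hu hx0]
        ring
      simp only [divS, hpd, Fin.sum_univ_three, lapE]
      have e := euler u hu hx0
      have e0 := euler2 u hu hx0 0
      have e1 := euler2 u hu hx0 1
      have e2 := euler2 u hu hx0 2
      have s01 := pd_symm hu hx0 0 1
      have s02 := pd_symm hu hx0 0 2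
      have s12 := pd_symm hu hx0 1 2
      have hn := nsq hx
      clear hpd d da dg
      rw [s01, s02] at e0
      rw [s12] at e1
      rw [s01, s02, s12]
      clear s01 s02 s12
      simp only [aw, gsq]
      generalize pd 0 (pd 0 (sphExt u)) x = h00 at *
      generalize pd 1 (pd 1 (sphExt u)) x = h11 at *
      generalize pd 2 (pd 2 (sphExt u)) x = h22 at *
      generalize pd 1 (pd 0 (sphExt u)) x = h01 at *
      generalize pd 2 (pd 0 (sphExt u)) x = h02 at *
      generalize pd 2 (pd 1 (sphExt u)) x = h12 at *
      generalize pd 0 (sphExt u) x = w0 at *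
      generalize pd 1 (sphExt u) x = w1 at *
      generalize pd 2 (sphExt u) x = w2 at *
      generalize x 0 = x0 at *
      generalize x 1 = x1 at *
      generalize x 2 = x2 at *
      generalize a 0 = a0 at *
      generalize a 1 = a1 at *
      generalize a 2 = a2 at *
      -- H x = - w
      have E0 : h00 * x0 + h01 * x1 + h02 * x2 = - w0 := by linarith
      have E1 : h01 * x0 + h11 * x1 + h12 * x2 = - w1 := by linarith
      have E2 : h02 * x0 + h12 * x1 + h22 * x2 = - w2 := by linarith
      linear_combination
        (-2 * (a0 * (h00 * x0 + h01 * x1 + h02 * x2) + a1 * (h01 * x0 + h11 * x1 + h12 * x2)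
          + a2 * (h02 * x0 + h12 * x1 + h22 * x2)) - 4 * (a0 * w0 + a1 * w1 + a2 * w2)
          + 2 * (a0 * w0 + a1 * w1 + a2 * w2)) * e
        + (-2 * (a0 * w0 + a1 * w1 + a2 * w2) * x0 + 2 * (a0 * x0 + a1 * x1 + a2 * x2) * w0) * E0
        + (-2 * (a0 * w0 + a1 * w1 + a2 * w2) * x1 + 2 * (a0 * x0 + a1 * x1 + a2 * x2) * w1) * E1
        + (-2 * (a0 * w0 + a1 * w1 + a2 * w2) * x2 + 2 * (a0 * x0 + a1 * x1 + a2 * x2) * w2) * E2)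
  rw [integral_const_mul] at key
  linarith

theorem exp_cd {F : (EuclideanSpace ℝ (Fin 3)) → ℝ} (hF : ContDiffOn ℝ 2 F {0}ᶜ) :
    ContDiffOn ℝ 1 (fun x => Real.exp (2 * F x)) {0}ᶜ :=
  (contDiffOn_const.mul (hF.of_le (by norm_num))).exp

theorem KW3 (a : (EuclideanSpace ℝ (Fin 3))) (u : (EuclideanSpace ℝ (Fin 3)) → ℝ) (hu : ContDiffOn ℝ 2 (sphExt u) {0}ᶜ) :
    ∫ x, (Real.exp (2 * sphExt u x) * (2 * aw a (sphExt u) x * (1 - lin a x)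
      - (a 0 ^ 2 + a 1 ^ 2 + a 2 ^ 2) - 2 * (1 - lin a x) * lin a x + lin a x ^ 2))
      ∂sphereMeasure = 0 := by
  refine div_thm (fun j x => Real.exp (2 * sphExt u x) * ((1 + (-1) * lin a x) * a j))
    (fun j => (exp_cd hu).mul ((contDiffOn_const.add (contDiffOn_const.mul (lin_cd a))).mul
      contDiffOn_const)) ?_
  intro x hx
  have hx0 := ne_of_norm hx
  have dF := cd_diff (hu.of_le (by norm_num)) hx0
  have de := cd_diff (exp_cd hu) hx0
  have dl := cd_diff (lin_cd a) hx0
  have c : ∀ r : ℝ, DifferentiableAt ℝ (fun _ : (EuclideanSpace ℝ (Fin 3)) => r) x := fun i => differentiableAt_const _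
  have hpd : ∀ k j, pd k (fun x => Real.exp (2 * sphExt u x) * ((1 + (-1) * lin a x) * a j)) x
      = 2 * Real.exp (2 * sphExt u x) * pd k (sphExt u) x * ((1 - lin a x) * a j)
        - Real.exp (2 * sphExt u x) * a k * a j := by
    intro k j
    rw [pd_mul de (((c 1).fun_add ((c (-1)).fun_mul dl)).fun_mul (c (a j))), pd_exp dF,
      pd_mul ((c 1).fun_add ((c (-1)).fun_mul dl)) (c (a j)), pd_add (c 1) ((c (-1)).fun_mul dl),
      pd_mul (c (-1)) dl, pd_const, pd_const, pd_const, pd_lin]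
    ring
  simp only [divS, hpd, Fin.sum_univ_three]
  have e := euler u hu hx0
  have hl := lin3 a x
  simp only [aw]
  rw [hl]
  linear_combination (- 2 * Real.exp (2 * sphExt u x) * (1 - (a 0 * x 0 + a 1 * x 1 + a 2 * x 2))
    * (a 0 * x 0 + a 1 * x 1 + a 2 * x 2)) * e

theorem KW4 (a : (EuclideanSpace ℝ (Fin 3))) (u : (EuclideanSpace ℝ (Fin 3)) → ℝ) (hu : ContDiffOn ℝ 2 (sphExt u) {0}ᶜ) :
    ∫ x, (aw a (sphExt u) x + lin a x * lapE (sphExt u) x) ∂sphereMeasure = 0 := by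
  refine div_thm (fun j x => lin a x * pd j (sphExt u) x)
    (fun j => (lin_cd a).mul (pd_cd hu j)) ?_
  intro x hx
  have hx0 := ne_of_norm hx
  have d : ∀ i, DifferentiableAt ℝ (pd i (sphExt u)) x := fun i => cd_diff (pd_cd hu i) hx0
  have dl := cd_diff (lin_cd a) hx0
  simp only [divS, pd_mul dl (d _), pd_lin, Fin.sum_univ_three, lapE, aw]
  have e := euler u hu hx0
  have e0 := euler2 u hu hx0 0
  have e1 := euler2 u hu hx0 1
  have e2 := euler2 u hu hx0 2
  have hl := lin3 a x
  rw [hl]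
  linear_combination (-(a 0 * x 0 + a 1 * x 1 + a 2 * x 2) * 2) * e
    - (a 0 * x 0 + a 1 * x 1 + a 2 * x 2) * (x 0 * e0 + x 1 * e1 + x 2 * e2)

theorem KW5 (a : (EuclideanSpace ℝ (Fin 3))) : ∫ x, lin a x ∂sphereMeasure = 0 := by
  have := div_thm (fun j _ => a j) (fun j => contDiffOn_const) (D := fun x => (-2) * lin a x) (by
    intro x hx
    simp only [divS, pd_const, lin3, Fin.sum_univ_three]
    ring)
  rw [integral_const_mul] at this
  linarith

theorem KW6 (a : (EuclideanSpace ℝ (Fin 3))) : ∫ x, ((a 0 ^ 2 + a 1 ^ 2 + a 2 ^ 2) - 3 * lin a x ^ 2) ∂sphereMeasure = 0 := by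
  refine div_thm (fun j x => lin a x * a j) (fun j => (lin_cd a).mul contDiffOn_const) ?_
  intro x hx
  have hx0 := ne_of_norm hx
  have dl := cd_diff (lin_cd a) hx0
  simp only [divS, pd_mul dl (differentiableAt_const _), pd_const, pd_lin, Fin.sum_univ_three]
  rw [lin3]
  ring

/-- if `u ∈ C²(S²)` solves
`α Δu + ((1 - a·x)/(1-|a|²)) e^{2u} - 1 = 0` with `∫ e^{2u} dω = 1`,
`∫ e^{2u} xᵢ dω = aᵢ`, where `0 < |a| < 1`, `α ∈ (0,1)`, `α ≠ 2/3`, then the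
Kazdan–Warner identities force `(3 - 2/α) ∫ (|a|² - (a·x)²) e^{2u} dω = 0`,
hence a contradiction (any such solution must have `a = 0`). -/
theorem stmt13 (α : ℝ) (a : EuclideanSpace ℝ (Fin 3))
    (u : EuclideanSpace ℝ (Fin 3) → ℝ)
    (hα : α ∈ Set.Ioo (0 : ℝ) 1) (hα23 : α ≠ 2 / 3)
    (ha : ‖a‖ < 1) (ha0 : a ≠ 0)
    (hu : ContDiffOn ℝ 2 (sphExt u) {0}ᶜ)
    (heq : ∀ x : EuclideanSpace ℝ (Fin 3), ‖x‖ = 1 →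
      α * sphLap u x + (1 - ∑ i, a i * x i) / (1 - ‖a‖ ^ 2) * Real.exp (2 * u x) - 1 = 0)
    (hmass : ∫ x, Real.exp (2 * u x) ∂sphereMeasure = 1)
    (hcenter : ∀ i : Fin 3, ∫ x, Real.exp (2 * u x) * x i ∂sphereMeasure = a i) :
    ((3 - 2 / α) *
        ∫ x, (‖a‖ ^ 2 - (∑ i, a i * x i) ^ 2) * Real.exp (2 * u x) ∂sphereMeasure = 0) ∧
      False := by
  have hα0 : α ≠ 0 := hα.1.ne'
  set F := sphExt u with hF
  have hFu : ∀ x : EuclideanSpace ℝ (Fin 3), ‖x‖ = 1 → F x = u x := by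
    intro x hx
    simp [hF, sphExt, hx]
  set N : ℝ := a 0 ^ 2 + a 1 ^ 2 + a 2 ^ 2 with hN
  have hNa : ‖a‖ ^ 2 = N := by
    rw [EuclideanSpace.real_norm_sq_eq, Fin.sum_univ_three]
  have hNpos : 0 < N := by
    rw [← hNa]
    have := norm_pos_iff.2 ha0
    positivity
  have hN1 : 1 - N ≠ 0 := by
    rw [← hNa]
    have := norm_nonneg a
    nlinarith
  -- continuity facts
  have cE : ContinuousOn (fun x => Real.exp (2 * F x)) {0}ᶜ := (exp_cd hu).continuousOn
  have cl : ContinuousOn (lin a) {0}ᶜ := (lin_cd a).continuousOn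
  have cw : ContinuousOn (aw a F) {0}ᶜ := (aw_cd a hu).continuousOn
  have cL : ContinuousOn (lapE F) {0}ᶜ := lapE_cont hu
  have iE := sm_int cE
  have iEl : Integrable (fun x => Real.exp (2 * F x) * lin a x) sphereMeasure :=
    sm_int (cE.mul cl)
  have iEll : Integrable (fun x => Real.exp (2 * F x) * lin a x ^ 2) sphereMeasure :=
    sm_int (cE.mul (cl.pow 2))
  have iw : Integrable (fun x => aw a F x) sphereMeasure := sm_int cw
  have il : Integrable (fun x => lin a x) sphereMeasure := sm_int cl
  have ilL : Integrable (fun x => lin a x * lapE F x) sphereMeasure := sm_int (cl.mul cL)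
  have iwL : Integrable (fun x => aw a F x * lapE F x) sphereMeasure := sm_int (cw.mul cL)
  have iR : Integrable (fun x => Real.exp (2 * F x) * (aw a F x * (1 - lin a x))) sphereMeasure :=
    sm_int (cE.mul (cw.mul (continuousOn_const.sub cl)))
  have hpde : ∀ x : EuclideanSpace ℝ (Fin 3), ‖x‖ = 1 →
      α * lapE F x + (1 - lin a x) / (1 - N) * Real.exp (2 * F x) - 1 = 0 := by
    intro x hx
    have h := heq x hx
    have h2 : sphLap u x = lapE F x := by
      unfold sphLap lapE
      rw [Fin.sum_univ_three]
      rfl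
    rw [h2, ← hFu x hx, hNa] at h
    exact h
  -- moments
  have m0 : ∫ x, Real.exp (2 * F x) ∂sphereMeasure = 1 := by
    rw [← hmass]
    refine integral_congr_ae ?_
    filter_upwards [sm_ae] with x hx
    rw [hFu x hx]
  have m1 : ∫ x, Real.exp (2 * F x) * lin a x ∂sphereMeasure = N := by
    have e1 : ∀ i, ∫ x, Real.exp (2 * F x) * x i ∂sphereMeasure = a i := by
      intro i
      rw [← hcenter i]
      refine integral_congr_ae ?_
      filter_upwards [sm_ae] with x hx
      rw [hFu x hx]
    have e2 : ∀ x : EuclideanSpace ℝ (Fin 3), Real.exp (2 * F x) * lin a x =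
        ∑ i, a i * (Real.exp (2 * F x) * x i) := by
      intro x
      simp only [lin, Finset.mul_sum]
      exact Finset.sum_congr rfl fun i _ => by ring
    simp only [e2]
    have e3 : ∀ i : Fin 3, Integrable (fun x => Real.exp (2 * F x) * x i) sphereMeasure :=
      fun i => sm_int (cE.mul (cd_coord i).continuousOn)
    rw [integral_finsetSum _ (fun i _ => (e3 i).const_mul (a i))]
    simp only [integral_const_mul, e1, Fin.sum_univ_three]
    rw [hN]; ring
  set M := ∫ x, Real.exp (2 * F x) * lin a x ^ 2 ∂sphereMeasure with hM
  set P := ∫ x, aw a F x ∂sphereMeasure with hP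
  set Q := ∫ x, lin a x * lapE F x ∂sphereMeasure with hQ
  set R := ∫ x, Real.exp (2 * F x) * (aw a F x * (1 - lin a x)) ∂sphereMeasure with hR
  have k1 : P + Q = 0 := by
    rw [hP, hQ, ← integral_add iw ilL]
    exact KW4 a u hu
  have k2 : 2 * R - N * 1 - 2 * N + 3 * M = 0 := by
    have h1 := KW3 a u hu
    have i1 : Integrable (fun x => 2 * (Real.exp (2 * F x) * (aw a F x * (1 - lin a x)))
        - N * Real.exp (2 * F x)) sphereMeasure := (iR.const_mul 2).sub (iE.const_mul N)
    have i2 : Integrable (fun x => 2 * (Real.exp (2 * F x) * (aw a F x * (1 - lin a x)))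
        - N * Real.exp (2 * F x) - 2 * (Real.exp (2 * F x) * lin a x)) sphereMeasure :=
      i1.sub (iEl.const_mul 2)
    have h2 : ∫ x, (2 * (Real.exp (2 * F x) * (aw a F x * (1 - lin a x)))
        - N * Real.exp (2 * F x) - 2 * (Real.exp (2 * F x) * lin a x)
        + 3 * (Real.exp (2 * F x) * lin a x ^ 2)) ∂sphereMeasure = 0 := by
      rw [← h1]
      refine integral_congr_ae (Filter.Eventually.of_forall fun x => ?_)
      simp only [← hF, ← hN]
      ring
    rw [integral_add i2 (iEll.const_mul 3), integral_sub i1 (iEl.const_mul 2),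
      integral_sub (iR.const_mul 2) (iE.const_mul N), integral_const_mul, integral_const_mul,
      integral_const_mul, integral_const_mul, m0, m1] at h2
    exact h2
  have k3 : (1 - N)⁻¹ * R - P = 0 := by
    have h1 := KW1 a u hu
    have h2 : ∫ x, (α * (aw a F x * lapE F x) + ((1 - N)⁻¹ * (Real.exp (2 * F x) *
        (aw a F x * (1 - lin a x))) - aw a F x)) ∂sphereMeasure = 0 := by
      rw [← integral_zero (EuclideanSpace ℝ (Fin 3)) ℝ (μ := sphereMeasure)]
      refine integral_congr_ae ?_
      filter_upwards [sm_ae] with x hx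
      have h := hpde x hx
      rw [div_eq_mul_inv] at h
      linear_combination aw a F x * h
    have i1 : Integrable (fun x => (1 - N)⁻¹ * (Real.exp (2 * F x) *
        (aw a F x * (1 - lin a x))) - aw a F x) sphereMeasure := (iR.const_mul _).sub iw
    rw [integral_add (iwL.const_mul α) i1, integral_const_mul,
      integral_sub (iR.const_mul _) iw, integral_const_mul] at h2
    rw [← hF] at h1
    rw [h1] at h2
    linarith
  have k4 : α * Q + (1 - N)⁻¹ * (N - M) = 0 := by
    have h1 := KW5 a
    have h2 : ∫ x, (α * (lin a x * lapE F x) + ((1 - N)⁻¹ * (Real.exp (2 * F x) * lin a x -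
        Real.exp (2 * F x) * lin a x ^ 2) - lin a x)) ∂sphereMeasure = 0 := by
      rw [← integral_zero (EuclideanSpace ℝ (Fin 3)) ℝ (μ := sphereMeasure)]
      refine integral_congr_ae ?_
      filter_upwards [sm_ae] with x hx
      have h := hpde x hx
      rw [div_eq_mul_inv] at h
      linear_combination lin a x * h
    have i1 : Integrable (fun x => Real.exp (2 * F x) * lin a x -
        Real.exp (2 * F x) * lin a x ^ 2) sphereMeasure := iEl.sub iEll
    have i2 : Integrable (fun x => (1 - N)⁻¹ * (Real.exp (2 * F x) * lin a x -
        Real.exp (2 * F x) * lin a x ^ 2) - lin a x) sphereMeasure := (i1.const_mul _).sub il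
    rw [integral_add (ilL.const_mul α) i2, integral_const_mul,
      integral_sub (i1.const_mul _) il, integral_const_mul,
      integral_sub iEl iEll, h1, m1] at h2
    linarith
  have hI : ∫ x, (‖a‖ ^ 2 - (∑ i, a i * x i) ^ 2) * Real.exp (2 * u x) ∂sphereMeasure = N - M := by
    have e : N - M = N * 1 - M := by ring
    rw [e, ← m0, hM, ← integral_const_mul, ← integral_sub (iE.const_mul N) iEll]
    refine integral_congr_ae ?_
    filter_upwards [sm_ae] with x hx
    rw [hNa, ← hFu x hx]
    simp only [lin]
    ring
  have hR2 : α * R = N - M := by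
    have h1 : (1 - N)⁻¹ * (α * R - (N - M)) = 0 := by
      linear_combination α * k3 + α * k1 - k4
    rcases mul_eq_zero.1 h1 with h | h
    · exact absurd h (inv_ne_zero hN1)
    · linarith
  have hfin : (3 - 2 / α) * (N - M) = 0 := by
    field_simp
    linear_combination (-α) * k2 + 2 * hR2
  have hNM : N - M = 0 := by
    rcases mul_eq_zero.1 hfin with h | h
    · exfalso
      apply hα23
      field_simp at h
      linarith
    · exact h
  refine ⟨by rw [hI]; exact hfin, ?_⟩
  -- the integrand is nonnegative and has zero integral
  have hCS : ∀ x : EuclideanSpace ℝ (Fin 3), ‖x‖ = 1 → 0 ≤ N - lin a x ^ 2 := by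
    intro x hx
    have h := nsq hx
    rw [lin3, hN]
    have h2 : a 0 ^ 2 + a 1 ^ 2 + a 2 ^ 2 = (a 0 ^ 2 + a 1 ^ 2 + a 2 ^ 2) *
      (x 0 ^ 2 + x 1 ^ 2 + x 2 ^ 2) := by rw [h, mul_one]
    rw [h2]
    nlinarith [sq_nonneg (a 0 * x 1 - a 1 * x 0), sq_nonneg (a 0 * x 2 - a 2 * x 0),
      sq_nonneg (a 1 * x 2 - a 2 * x 1)]
  have hz : ∫ x, (N * Real.exp (2 * F x) - Real.exp (2 * F x) * lin a x ^ 2) ∂sphereMeasure = 0 := by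
    rw [integral_sub (iE.const_mul N) iEll, integral_const_mul, m0]
    linarith
  have hae := (integral_eq_zero_iff_of_nonneg_ae (by
    filter_upwards [sm_ae] with x hx
    have h := mul_nonneg (hCS x hx) (Real.exp_pos (2 * F x)).le
    simp only [Pi.zero_apply, Pi.sub_apply]
    linarith) ((iE.const_mul N).sub iEll)).1 hz
  have hfinite := sm_finite
  have h6 : ∫ x : EuclideanSpace ℝ (Fin 3), (-2 * N) ∂sphereMeasure = 0 := by
    rw [← KW6 a]
    refine integral_congr_ae ?_
    filter_upwards [hae] with x hx
    simp only [Pi.zero_apply, Pi.sub_apply] at hx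
    have h : Real.exp (2 * F x) * (N - lin a x ^ 2) = 0 := by linarith
    rcases mul_eq_zero.1 h with h | h
    · exact absurd h (Real.exp_pos _).ne'
    · linarith
  rw [integral_const, smul_eq_mul] at h6
  rcases mul_eq_zero.1 h6 with h | h
  · have h7 : sphereMeasure = 0 := by
      have h8 := (measureReal_eq_zero_iff).1 h
      exact Measure.measure_univ_eq_zero.1 h8
    rw [h7] at hmass
    simp at hmass
  · linarith
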